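/- arXiv:2404.05153 — 2 statements merged into one kernel-verified Lean document; each statement's English description precedes it below -/
import Mathlib

section
/- Let (X, d_X) be a complete ℝ-tree of length at most 5π/4 with d_GH(X, S¹) = π/4, and let x₋, x₊ ∈ X be points with d_X(x₋, x₊) = diam(X). Then diam(X) = π, and X is a tripod with extreme points x₋, x₊ and a third point x₁: namely, X is the union of the geodesic segment [x₋, x₊] (of length π) and a geodesic segment of length π/4 joining x₁ to its nearest point on [x₋, x₊], i.e., d_X(x₁, [x₋,x₊]) = π/4 and X = [x₋,x₊] ∪ [x₁, Π(x₁)] where Π(x₁) is the nearest-point projection of x₁ to [x₋,x₊]. -/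
open Real Set Metric
open scoped ENNReal unitInterval

noncomputable section

/-- A *length space*: the distance between any two points equals the infimum of the
lengths (total variations) of continuous paths joining them. -/
def IsLengthSpace (X : Type*) [MetricSpace X] : Prop :=
  ∀ x y : X,
    ENNReal.ofReal (dist x y) =
      ⨅ γ ∈ {γ : ℝ → X | ContinuousOn γ (Set.Icc 0 1) ∧ γ 0 = x ∧ γ 1 = y},
        eVariationOn γ (Set.Icc 0 1)

/-- A *geodesic space*: any two points are joined by a path whose length equals
their distance. -/
def IsGeodesicSpace (X : Type*) [MetricSpace X] : Prop :=
  ∀ x y : X, ∃ γ : ℝ → X, ContinuousOn γ (Set.Icc 0 1) ∧ γ 0 = x ∧ γ 1 = y ∧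
    eVariationOn γ (Set.Icc 0 1) = ENNReal.ofReal (dist x y)

/-- A continuous map `γ : [0,1] → Y` is a loop if its endpoints agree. -/
def IsLoop {Y : Type*} [TopologicalSpace Y] (γ : C(unitInterval, Y)) : Prop := γ 0 = γ 1

/-- Two loops are homotopic *through loops* (free homotopy of loops). -/
def LoopHomotopic {Y : Type*} [TopologicalSpace Y] (γ γ' : C(unitInterval, Y)) : Prop :=
  ∃ H : C(unitInterval × unitInterval, Y),
    (∀ t, H (0, t) = γ t) ∧ (∀ t, H (1, t) = γ' t) ∧ ∀ s, H (s, 0) = H (s, 1)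

/-- A loop is nulhomotopic if it is homotopic, through loops, to a constant loop. -/
def IsNullLoop {Y : Type*} [TopologicalSpace Y] (γ : C(unitInterval, Y)) : Prop :=
  ∃ y : Y, LoopHomotopic γ (ContinuousMap.const _ y)

/-- A correspondence between `X` and `Y`: a relation whose two projections are surjective. -/
def IsCorrespondence {X Y : Type*} (R : Set (X × Y)) : Prop :=
  (∀ x : X, ∃ y : Y, (x, y) ∈ R) ∧ (∀ y : Y, ∃ x : X, (x, y) ∈ R)

/-- The distortion of a relation `R ⊆ X × Y`,
`dis R = sup {|d_X(x,x') − d_Y(y,y')| : (x,y), (x',y') ∈ R}` (in `ℝ≥0∞`). -/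
noncomputable def distortion {X Y : Type*} [MetricSpace X] [MetricSpace Y]
    (R : Set (X × Y)) : ℝ≥0∞ :=
  ⨆ (p : R) (q : R),
    ENNReal.ofReal |dist (p : X × Y).1 (q : X × Y).1 - dist (p : X × Y).2 (q : X × Y).2|

/-- The Gromov–Hausdorff distance, expressed as half the infimal distortion of
correspondences between `X` and `Y` (valued in `ℝ≥0∞`). -/
noncomputable def ghDist (X Y : Type*) [MetricSpace X] [MetricSpace Y] : ℝ≥0∞ :=
  (⨅ R : {R : Set (X × Y) // IsCorrespondence R}, distortion (R : Set (X × Y))) / 2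

/-- The circle of circumference `2π`, i.e. `ℝ/2πℤ`, with its intrinsic (quotient) metric. -/
abbrev IntrinsicCircle := AddCircle (2 * π)

instance : Fact ((0:ℝ) < 2 * π) := ⟨by positivity⟩

/-- The lengths `π/2, π/2, π/4` of the three legs of the tripod `E`. -/
def tripodLeg : Fin 3 → ℝ := ![π/2, π/2, π/4]

/-- The tripod `E`: three segments of lengths `π/2`, `π/2`, `π/4` glued at a common
endpoint (the origin), realized as a union of coordinate segments in `ℝ³` with the
`ℓ¹`-metric; the induced metric is exactly the path metric of the tripod. -/
def TripodSet : Set (PiLp 1 fun _ : Fin 3 => ℝ) :=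
  {p | ∃ (i : Fin 3) (t : ℝ), 0 ≤ t ∧ t ≤ tripodLeg i ∧
    p = (WithLp.equiv 1 (∀ _ : Fin 3, ℝ)).symm (fun j => if j = i then t else 0)}

/-- The tripod `E` as a metric space. -/
abbrev TripodE : Type := ↥TripodSet

/-- An arc from `x` to `y`: a subspace homeomorphic to `[0,1]`, with endpoints `x` and `y`. -/
def IsArcBetween {X : Type*} [TopologicalSpace X] (x y : X) (A : Set X) : Prop :=
  ∃ γ : C(unitInterval, X), Function.Injective γ ∧ γ 0 = x ∧ γ 1 = y ∧ Set.range γ = A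

/-- An `ℝ`-tree: every pair of distinct points is joined by a unique arc, and this arc
is a geodesic segment (isometric to a real interval). -/
def IsRTree (X : Type*) [MetricSpace X] : Prop :=
  ∀ x y : X, x ≠ y →
    (∃! A : Set X, IsArcBetween x y A) ∧
    ∀ A : Set X, IsArcBetween x y A →
      ∃ γ : ℝ → X, γ 0 = x ∧ γ (dist x y) = y ∧
        γ '' Set.Icc 0 (dist x y) = A ∧
        ∀ s ∈ Set.Icc 0 (dist x y), ∀ t ∈ Set.Icc 0 (dist x y), dist (γ s) (γ t) = |s - t|

/-- The length of an `ℝ`-tree: the supremum of sums of lengths of pairwise disjoint arcs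
contained in it.  (In an `ℝ`-tree every arc is a geodesic segment, so its length is its
diameter.) -/
noncomputable def treeLength (X : Type*) [MetricSpace X] : ℝ≥0∞ :=
  ⨆ (S : Finset (Set X)) (_ : (∀ A ∈ S, ∃ x y : X, x ≠ y ∧ IsArcBetween x y A) ∧
      (S : Set (Set X)).Pairwise Disjoint), ∑ A ∈ S, EMetric.diam A

/-- The metric segment between `x` and `y`. -/
def metricSegment {X : Type*} [MetricSpace X] (x y : X) : Set X :=
  {w | dist x w + dist w y = dist x y}

section RTree

variable {X : Type*} [MetricSpace X]

theorem left_mem_metricSegment (x y : X) : x ∈ metricSegment x y := by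
  simp [metricSegment]

theorem right_mem_metricSegment (x y : X) : y ∈ metricSegment x y := by
  simp [metricSegment]

theorem metricSegment_comm (x y : X) : metricSegment x y = metricSegment y x := by
  ext w
  simp only [metricSegment, mem_ofPred_eq, dist_comm y w, dist_comm w x, dist_comm y x]
  rw [add_comm]

theorem dist_le_of_mem_metricSegment {x y w : X} (hw : w ∈ metricSegment x y) :
    dist x w ≤ dist x y := by
  have hw' : dist x w + dist w y = dist x y := hw
  linarith [dist_nonneg (x := w) (y := y)]

theorem metricSegment_subset_left {x y w : X} (hw : w ∈ metricSegment x y) :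
    metricSegment x w ⊆ metricSegment x y := by
  intro v hv
  have hw' : dist x w + dist w y = dist x y := hw
  have hv' : dist x v + dist v w = dist x w := hv
  have h₁ := dist_triangle v w y
  have h₂ := dist_triangle x v y
  change dist x v + dist v y = dist x y
  linarith

/-- A globally continuous parametrization of a geodesic in an `ℝ`-tree. -/
theorem IsRTree.exists_continuous_geodesic (hX : IsRTree X) (x y : X) :
    ∃ γ : ℝ → X, Continuous γ ∧ γ 0 = x ∧ γ (dist x y) = y ∧
      ∀ s ∈ Icc 0 (dist x y), ∀ t ∈ Icc 0 (dist x y), dist (γ s) (γ t) = |s - t| := by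
  rcases eq_or_ne x y with rfl | hxy
  · refine ⟨fun _ => x, continuous_const, rfl, rfl, fun s hs t ht => ?_⟩
    simp only [dist_self, Icc_self, mem_singleton_iff] at hs ht ⊢
    simp [hs, ht]
  · obtain ⟨⟨A, hA, -⟩, h⟩ := hX x y hxy
    obtain ⟨γ, h0, h1, -, hiso⟩ := h A hA
    have hd : (0 : ℝ) ≤ dist x y := dist_nonneg
    have hl : (0 : ℝ) ∈ Icc 0 (dist x y) := left_mem_Icc.2 hd
    have hr : dist x y ∈ Icc 0 (dist x y) := right_mem_Icc.2 hd
    have hmain : Isometry ((Icc 0 (dist x y)).domRestrict γ) :=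
      Isometry.of_dist_eq fun s t => by
        rw [Subtype.dist_eq, Real.dist_eq]
        exact hiso s s.2 t t.2
    refine ⟨IccExtend hd ((Icc 0 (dist x y)).domRestrict γ), hmain.continuous.Icc_extend',
      ?_, ?_, ?_⟩
    · rw [IccExtend_of_mem hd _ hl]; exact h0
    · rw [IccExtend_of_mem hd _ hr]; exact h1
    · intro s hs t ht
      rw [IccExtend_of_mem hd _ hs, IccExtend_of_mem hd _ ht]
      exact hiso s hs t ht

/-- Two segments of an `ℝ`-tree meeting only at a common endpoint concatenate to an arc. -/
theorem IsRTree.mem_of_isArcBetween (hX : IsRTree X) {x y z : X} {A : Set X}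
    (hA : IsArcBetween x z A)
    (h : metricSegment x y ∩ metricSegment y z ⊆ {y}) (hxz : x ≠ z) : y ∈ A := by
  obtain ⟨f, hfc, hf0, hf1, hf⟩ := hX.exists_continuous_geodesic x y
  obtain ⟨g, hgc, hg0, hg1, hg⟩ := hX.exists_continuous_geodesic y z
  set a := dist x y with ha
  set b := dist y z with hb
  have ha0 : 0 ≤ a := dist_nonneg
  have hb0 : 0 ≤ b := dist_nonneg
  have hab : 0 < a + b := (dist_pos.2 hxz).trans_le (dist_triangle x y z)
  have hfseg : ∀ s ∈ Icc 0 a, f s ∈ metricSegment x y := by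
    intro s hs
    have h₁ := hf 0 (left_mem_Icc.2 ha0) s hs
    have h₂ := hf s hs a (right_mem_Icc.2 ha0)
    rw [hf0, zero_sub, abs_neg, abs_of_nonneg hs.1] at h₁
    rw [hf1, abs_sub_comm, abs_of_nonneg (sub_nonneg.2 hs.2)] at h₂
    change dist x (f s) + dist (f s) y = dist x y
    linarith
  have hgseg : ∀ s ∈ Icc 0 b, g s ∈ metricSegment y z := by
    intro s hs
    have h₁ := hg 0 (left_mem_Icc.2 hb0) s hs
    have h₂ := hg s hs b (right_mem_Icc.2 hb0)
    rw [hg0, zero_sub, abs_neg, abs_of_nonneg hs.1] at h₁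
    rw [hg1, abs_sub_comm, abs_of_nonneg (sub_nonneg.2 hs.2)] at h₂
    change dist y (g s) + dist (g s) z = dist y z
    linarith
  have hcross : ∀ s ∈ Icc 0 a, ∀ t ∈ Icc 0 b, f s = g t → s = a ∧ t = 0 := by
    intro s hs t ht hst
    have h₁ : f s = y := h ⟨hfseg s hs, hst ▸ hgseg t ht⟩
    have h₂ := hf s hs a (right_mem_Icc.2 ha0)
    have h₃ := hg t ht 0 (left_mem_Icc.2 hb0)
    rw [h₁, hf1, dist_self] at h₂
    rw [← hst, h₁, hg0, dist_self] at h₃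
    exact ⟨by linarith [abs_eq_zero.1 h₂.symm], by linarith [abs_eq_zero.1 h₃.symm]⟩
  have hfinj : ∀ s ∈ Icc 0 a, ∀ t ∈ Icc 0 a, f s = f t → s = t := by
    intro s hs t ht hst
    have h₁ := hf s hs t ht
    rw [hst, dist_self] at h₁
    linarith [abs_eq_zero.1 h₁.symm]
  have hginj : ∀ s ∈ Icc 0 b, ∀ t ∈ Icc 0 b, g s = g t → s = t := by
    intro s hs t ht hst
    have h₁ := hg s hs t ht
    rw [hst, dist_self] at h₁
    linarith [abs_eq_zero.1 h₁.symm]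
  let φ : ℝ → X := fun s => if s ≤ a then f s else g (s - a)
  have hφc : Continuous φ := by
    refine Continuous.if_le hfc (hgc.comp (continuous_id.sub continuous_const)) continuous_id
      continuous_const ?_
    rintro s rfl
    simp only [sub_self, hg0]
    exact hf1
  have hφinj : ∀ s ∈ Icc 0 (a + b), ∀ t ∈ Icc 0 (a + b), φ s = φ t → s = t := by
    intro s hs t ht hst
    simp only [φ] at hst
    split_ifs at hst with h₁ h₂ h₂
    · exact hfinj s ⟨hs.1, h₁⟩ t ⟨ht.1, h₂⟩ hst
    · push Not at h₂
      have := hcross s ⟨hs.1, h₁⟩ (t - a) ⟨by linarith, by linarith [ht.2]⟩ hst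
      linarith
    · push Not at h₁
      have := hcross t ⟨ht.1, h₂⟩ (s - a) ⟨by linarith, by linarith [hs.2]⟩ hst.symm
      linarith
    · push Not at h₁ h₂
      have := hginj (s - a) ⟨by linarith, by linarith [hs.2]⟩ (t - a)
        ⟨by linarith, by linarith [ht.2]⟩ hst
      linarith
  have hmem : ∀ u : unitInterval, (a + b) * (u : ℝ) ∈ Icc 0 (a + b) := fun u =>
    ⟨mul_nonneg hab.le u.2.1, mul_le_of_le_one_right hab.le u.2.2⟩
  let ψ : C(unitInterval, X) :=
    ⟨fun u => φ ((a + b) * u), hφc.comp (continuous_const.mul continuous_subtype_val)⟩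
  have hψ : IsArcBetween x z (range ψ) := by
    refine ⟨ψ, fun u v huv => ?_, ?_, ?_, rfl⟩
    · exact Subtype.ext (mul_left_cancel₀ hab.ne' (hφinj _ (hmem u) _ (hmem v) huv))
    · change φ ((a + b) * ((0 : unitInterval) : ℝ)) = x
      simp [φ, ha0, hf0]
    · change φ ((a + b) * ((1 : unitInterval) : ℝ)) = z
      rw [show ((1 : unitInterval) : ℝ) = 1 from rfl, mul_one]
      simp only [φ, add_sub_cancel_left, hg1]
      split_ifs with h₁
      · have hb' : b = 0 := by linarith
        rw [hb', add_zero, hf1]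
        exact dist_eq_zero.1 (hb.symm.trans hb')
      · rfl
  rw [(hX x z hxz).1.unique hA hψ]
  refine ⟨⟨a / (a + b), div_nonneg ha0 hab.le, (div_le_one hab).2 (by linarith)⟩, ?_⟩
  change φ ((a + b) * (a / (a + b))) = y
  rw [mul_div_cancel₀ _ hab.ne']
  simp [φ, hf1]

/-- The arcs of an `ℝ`-tree are its metric segments. -/
theorem IsRTree.isArcBetween_eq (hX : IsRTree X) {x z : X} {A : Set X} (hxz : x ≠ z)
    (hA : IsArcBetween x z A) : A = metricSegment x z := by
  apply Subset.antisymm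
  · obtain ⟨γ, h0, h1, rfl, hiso⟩ := (hX x z hxz).2 A hA
    rintro _ ⟨s, hs, rfl⟩
    have h₁ := hiso 0 (left_mem_Icc.2 dist_nonneg) s hs
    have h₂ := hiso s hs _ (right_mem_Icc.2 dist_nonneg)
    rw [h0, zero_sub, abs_neg, abs_of_nonneg hs.1] at h₁
    rw [h1, abs_sub_comm, abs_of_nonneg (sub_nonneg.2 hs.2)] at h₂
    change dist x (γ s) + dist (γ s) z = dist x z
    linarith
  · intro w hw
    refine hX.mem_of_isArcBetween hA ?_ hxz
    rintro v ⟨hv₁, hv₂⟩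
    have e₁ : dist x w + dist w z = dist x z := hw
    have e₂ : dist x v + dist v w = dist x w := hv₁
    have e₃ : dist w v + dist v z = dist w z := hv₂
    have h₁ := dist_triangle x v z
    have h₂ := dist_comm v w
    exact dist_le_zero.1 (by linarith)

theorem IsRTree.isArcBetween_metricSegment (hX : IsRTree X) {x y : X} (hxy : x ≠ y) :
    IsArcBetween x y (metricSegment x y) := by
  obtain ⟨A, hA, -⟩ := (hX x y hxy).1
  exact hX.isArcBetween_eq hxy hA ▸ hA

/-- A metric segment in an `ℝ`-tree has an isometric parametrization. -/
theorem IsRTree.exists_parametrization (hX : IsRTree X) (x y : X) :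
    ∃ γ : ℝ → X, γ 0 = x ∧ γ (dist x y) = y ∧
      γ '' Icc 0 (dist x y) = metricSegment x y ∧
      ∀ s ∈ Icc 0 (dist x y), ∀ t ∈ Icc 0 (dist x y), dist (γ s) (γ t) = |s - t| := by
  rcases eq_or_ne x y with rfl | hxy
  · refine ⟨fun _ => x, rfl, rfl, ?_, fun s hs t ht => ?_⟩
    · ext w
      simp only [dist_self, Icc_self, image_singleton, mem_singleton_iff, metricSegment,
        mem_ofPred_eq]
      rw [dist_comm w x]
      constructor
      · rintro rfl; simp
      · intro h
        exact (dist_le_zero.1 (by linarith)).symm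
    · simp only [dist_self, Icc_self, mem_singleton_iff] at hs ht ⊢
      simp [hs, ht]
  · exact (hX x y hxy).2 _ (hX.isArcBetween_metricSegment hxy)

theorem IsRTree.isCompact_metricSegment (hX : IsRTree X) (x y : X) :
    IsCompact (metricSegment x y) := by
  obtain ⟨γ, -, -, himg, hiso⟩ := hX.exists_parametrization x y
  rw [← himg]
  refine isCompact_Icc.image_of_continuousOn ?_
  rw [continuousOn_iff_continuous_domRestrict]
  refine Isometry.continuous (Isometry.of_dist_eq fun s t => ?_)
  rw [Subtype.dist_eq, Real.dist_eq]
  exact hiso s s.2 t t.2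

theorem IsRTree.exists_mem_metricSegment_dist_eq (hX : IsRTree X) (x y : X) {t : ℝ}
    (ht : t ∈ Icc 0 (dist x y)) : ∃ w ∈ metricSegment x y, dist x w = t := by
  obtain ⟨γ, h0, -, himg, hiso⟩ := hX.exists_parametrization x y
  refine ⟨γ t, himg ▸ mem_image_of_mem γ ht, ?_⟩
  have h := hiso 0 (left_mem_Icc.2 dist_nonneg) t ht
  rwa [h0, zero_sub, abs_neg, abs_of_nonneg ht.1] at h

theorem IsRTree.dist_eq_add (hX : IsRTree X) {x y z : X}
    (h : metricSegment x y ∩ metricSegment y z ⊆ {y}) :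
    dist x z = dist x y + dist y z := by
  rcases eq_or_ne x z with rfl | hxz
  · have : x = y := h ⟨left_mem_metricSegment x y, right_mem_metricSegment y x⟩
    simp [this]
  · exact (hX.mem_of_isArcBetween (hX.isArcBetween_metricSegment hxz) h hxz).symm

/-- A point of a metric segment splits it into two subsegments. -/
theorem IsRTree.mem_or_mem_of_mem_metricSegment (hX : IsRTree X) {x z p v : X}
    (hp : p ∈ metricSegment x z) (hv : v ∈ metricSegment x z) :
    v ∈ metricSegment x p ∨ v ∈ metricSegment p z := by
  obtain ⟨γ, h0, h1, himg, hiso⟩ := hX.exists_parametrization x z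
  have hl : (0 : ℝ) ∈ Icc 0 (dist x z) := left_mem_Icc.2 dist_nonneg
  have hr : dist x z ∈ Icc 0 (dist x z) := right_mem_Icc.2 dist_nonneg
  rw [← himg] at hp hv
  obtain ⟨t, ht, rfl⟩ := hp
  obtain ⟨s, hs, rfl⟩ := hv
  rcases le_total s t with hst | hst
  · left
    change dist x (γ s) + dist (γ s) (γ t) = dist x (γ t)
    nth_rewrite 1 2 [← h0]
    rw [hiso 0 hl s hs, hiso s hs t ht, hiso 0 hl t ht, zero_sub, abs_neg, abs_of_nonneg hs.1,
      abs_sub_comm, abs_of_nonneg (sub_nonneg.2 hst), zero_sub, abs_neg, abs_of_nonneg ht.1]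
    ring
  · right
    change dist (γ t) (γ s) + dist (γ s) z = dist (γ t) z
    nth_rewrite 1 2 [← h1]
    rw [hiso t ht s hs, hiso s hs _ hr, hiso t ht _ hr, abs_sub_comm t s,
      abs_of_nonneg (sub_nonneg.2 hst), abs_sub_comm, abs_of_nonneg (sub_nonneg.2 hs.2),
      abs_sub_comm, abs_of_nonneg (sub_nonneg.2 ht.2)]
    ring

/-- Metric segments in an `ℝ`-tree are convex. -/
theorem IsRTree.metricSegment_subset (hX : IsRTree X) {x z p q : X}
    (hp : p ∈ metricSegment x z) (hq : q ∈ metricSegment x z) :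
    metricSegment p q ⊆ metricSegment x z := by
  rcases hX.mem_or_mem_of_mem_metricSegment hp hq with h | h
  · rw [metricSegment_comm p q]
    intro v hv
    refine metricSegment_subset_left hp ?_
    rw [metricSegment_comm] at h hv ⊢
    exact metricSegment_subset_left h hv
  · intro v hv
    have := metricSegment_subset_left h hv
    rw [metricSegment_comm] at hp this ⊢
    exact metricSegment_subset_left hp this

/-- Distances from a point to a segment of an `ℝ`-tree pass through a nearest point. -/
theorem IsRTree.dist_eq_of_nearest (hX : IsRTree X) {x z y p a : X}
    (hp : p ∈ metricSegment x z) (hmin : ∀ q ∈ metricSegment x z, dist y p ≤ dist y q)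
    (ha : a ∈ metricSegment x z) : dist y a = dist y p + dist p a := by
  refine hX.dist_eq_add ?_
  rintro v ⟨hv₁, hv₂⟩
  have h := hmin v (hX.metricSegment_subset hp ha hv₂)
  have hv : dist y v + dist v p = dist y p := hv₁
  exact dist_le_zero.1 (by linarith)

theorem nearest_of_mem_metricSegment {S : Set X} {y p v : X}
    (hmin : ∀ q ∈ S, dist y p ≤ dist y q) (hv : v ∈ metricSegment y p) :
    ∀ q ∈ S, dist v p ≤ dist v q := by
  intro q hq
  have h₁ : dist y v + dist v p = dist y p := hv
  have h₂ := hmin q hq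
  have h₃ := dist_triangle y v q
  linarith

/-- Two points with distinct nearest points on a segment of an `ℝ`-tree are joined
through these nearest points. -/
theorem IsRTree.dist_eq_of_nearest_ne (hX : IsRTree X) {x z y p y' p' : X}
    (hp : p ∈ metricSegment x z) (hmin : ∀ q ∈ metricSegment x z, dist y p ≤ dist y q)
    (hp' : p' ∈ metricSegment x z) (hmin' : ∀ q ∈ metricSegment x z, dist y' p' ≤ dist y' q)
    (hne : p ≠ p') : dist y y' = dist y p + dist p p' + dist y' p' := by
  have h₁ := hX.dist_eq_of_nearest hp hmin hp'
  suffices dist y y' = dist y p' + dist p' y' by rw [this, h₁, dist_comm y' p']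
  refine hX.dist_eq_add ?_
  rintro v ⟨hv₁, hv₂⟩
  rw [metricSegment_comm] at hv₂
  have hv := nearest_of_mem_metricSegment hmin' hv₂
  rcases hX.mem_or_mem_of_mem_metricSegment (p := p) h₁.symm hv₁ with h | h
  · have e₁ := hX.dist_eq_of_nearest hp (nearest_of_mem_metricSegment hmin h) hp'
    have e₂ := hv p hp
    exact absurd (dist_le_zero.1 (by linarith)) hne
  · have := hv v (hX.metricSegment_subset hp hp' h)
    rw [dist_self] at this
    exact dist_le_zero.1 this

end RTree

section TreeLength

variable {X : Type*} [MetricSpace X]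

theorem ofReal_dist_le_ediam_metricSegment (x y : X) :
    ENNReal.ofReal (dist x y) ≤ Metric.ediam (metricSegment x y) := by
  rw [← edist_dist]
  exact edist_le_ediam_of_mem (left_mem_metricSegment x y) (right_mem_metricSegment x y)

theorem ne_of_disjoint_metricSegment {x y : X} {S : Set X}
    (h : Disjoint (metricSegment x y) S) : metricSegment x y ≠ S := by
  rintro rfl
  exact disjoint_left.1 h (left_mem_metricSegment x y) (left_mem_metricSegment x y)

theorem IsRTree.dist_add_dist_le_of_disjoint (hX : IsRTree X) {L : ℝ} (hL : 0 ≤ L)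
    (hlen : treeLength X ≤ ENNReal.ofReal L) {x₁ y₁ x₂ y₂ : X} (h₁ : x₁ ≠ y₁) (h₂ : x₂ ≠ y₂)
    (h₁₂ : Disjoint (metricSegment x₁ y₁) (metricSegment x₂ y₂)) :
    dist x₁ y₁ + dist x₂ y₂ ≤ L := by
  classical
  have hsum := (le_iSup₂_of_le (f := fun (S : Finset (Set X))
    (_ : (∀ A ∈ S, ∃ x y : X, x ≠ y ∧ IsArcBetween x y A) ∧
      (S : Set (Set X)).Pairwise Disjoint) => ∑ A ∈ S, Metric.ediam A)
    {metricSegment x₁ y₁, metricSegment x₂ y₂} ⟨?_, ?_⟩ le_rfl).trans hlen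
  · rw [Finset.sum_pair (ne_of_disjoint_metricSegment h₁₂)] at hsum
    rw [← ENNReal.ofReal_le_ofReal_iff hL, ENNReal.ofReal_add dist_nonneg dist_nonneg]
    exact (add_le_add (ofReal_dist_le_ediam_metricSegment _ _)
      (ofReal_dist_le_ediam_metricSegment _ _)).trans hsum
  · simp only [Finset.mem_insert, Finset.mem_singleton]
    rintro A (rfl | rfl)
    · exact ⟨x₁, y₁, h₁, hX.isArcBetween_metricSegment h₁⟩
    · exact ⟨x₂, y₂, h₂, hX.isArcBetween_metricSegment h₂⟩
  · rw [Finset.coe_pair]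
    exact (pairwise_pair_of_symm).2 fun _ => h₁₂

theorem IsRTree.dist_add_dist_add_dist_le_of_disjoint (hX : IsRTree X) {L : ℝ} (hL : 0 ≤ L)
    (hlen : treeLength X ≤ ENNReal.ofReal L) {x₁ y₁ x₂ y₂ x₃ y₃ : X}
    (h₁ : x₁ ≠ y₁) (h₂ : x₂ ≠ y₂) (h₃ : x₃ ≠ y₃)
    (h₁₂ : Disjoint (metricSegment x₁ y₁) (metricSegment x₂ y₂))
    (h₁₃ : Disjoint (metricSegment x₁ y₁) (metricSegment x₃ y₃))
    (h₂₃ : Disjoint (metricSegment x₂ y₂) (metricSegment x₃ y₃)) :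
    dist x₁ y₁ + dist x₂ y₂ + dist x₃ y₃ ≤ L := by
  classical
  have hsum := (le_iSup₂_of_le (f := fun (S : Finset (Set X))
    (_ : (∀ A ∈ S, ∃ x y : X, x ≠ y ∧ IsArcBetween x y A) ∧
      (S : Set (Set X)).Pairwise Disjoint) => ∑ A ∈ S, Metric.ediam A)
    {metricSegment x₁ y₁, metricSegment x₂ y₂, metricSegment x₃ y₃} ⟨?_, ?_⟩ le_rfl).trans hlen
  · rw [Finset.sum_insert, Finset.sum_pair (ne_of_disjoint_metricSegment h₂₃)] at hsum
    · rw [← ENNReal.ofReal_le_ofReal_iff hL, add_assoc,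
        ENNReal.ofReal_add dist_nonneg (add_nonneg dist_nonneg dist_nonneg),
        ENNReal.ofReal_add dist_nonneg dist_nonneg]
      exact (add_le_add (ofReal_dist_le_ediam_metricSegment _ _)
        (add_le_add (ofReal_dist_le_ediam_metricSegment _ _)
          (ofReal_dist_le_ediam_metricSegment _ _))).trans hsum
    · simp only [Finset.mem_insert, Finset.mem_singleton, not_or]
      exact ⟨ne_of_disjoint_metricSegment h₁₂, ne_of_disjoint_metricSegment h₁₃⟩
  · simp only [Finset.mem_insert, Finset.mem_singleton]
    rintro A (rfl | rfl | rfl)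
    · exact ⟨x₁, y₁, h₁, hX.isArcBetween_metricSegment h₁⟩
    · exact ⟨x₂, y₂, h₂, hX.isArcBetween_metricSegment h₂⟩
    · exact ⟨x₃, y₃, h₃, hX.isArcBetween_metricSegment h₃⟩
  · rw [Finset.coe_insert, Finset.coe_pair]
    refine (pairwise_insert_of_symm).2 ⟨(pairwise_pair_of_symm).2 fun _ => h₂₃, ?_⟩
    rintro B (rfl | rfl) -
    · exact h₁₂
    · exact h₁₃

/-- A segment towards a nearest point of `S` can be shortened to avoid `S`. -/
theorem IsRTree.exists_shortened_segment (hX : IsRTree X) {S : Set X} {y m : X}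
    (hmin : ∀ q ∈ S, dist y m ≤ dist y q) {η : ℝ} (hη : 0 < η) (hηm : η < dist y m) :
    ∃ w ∈ metricSegment y m, y ≠ w ∧ dist y w = dist y m - η ∧ Disjoint (metricSegment y w) S := by
  obtain ⟨w, hw, hd⟩ := hX.exists_mem_metricSegment_dist_eq y m (t := dist y m - η)
    ⟨by linarith, by linarith⟩
  refine ⟨w, hw, ?_, hd, ?_⟩
  · rintro rfl
    rw [dist_self] at hd
    linarith
  · rw [disjoint_left]
    intro v hv hvS
    have := hmin v hvS
    have := dist_le_of_mem_metricSegment hv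
    linarith

/-- Lower bound for the length of an `ℝ`-tree containing a segment, a branch off this segment
and a further point. -/
theorem IsRTree.dist_add_dist_add_dist_le (hX : IsRTree X) {L : ℝ} (hL : 0 ≤ L)
    (hlen : treeLength X ≤ ENNReal.ofReal L) {x z y p y' m : X} (hxz : x ≠ z)
    (hmin : ∀ q ∈ metricSegment x z, dist y p ≤ dist y q) (hyp : y ≠ p)
    (hmin' : ∀ q ∈ metricSegment x z ∪ metricSegment y p, dist y' m ≤ dist y' q) :
    dist x z + dist y p + dist y' m ≤ L := by
  refine le_of_forall_pos_le_add fun ε hε => ?_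
  have hp0 : 0 < dist y p := dist_pos.2 hyp
  rcases eq_or_ne y' m with rfl | hm
  · obtain ⟨η, hη, hηm⟩ := exists_between (lt_min hε hp0)
    obtain ⟨w, -, hyw, hd, hdisj⟩ := hX.exists_shortened_segment hmin hη
      (hηm.trans_le (min_le_right _ _))
    have := hX.dist_add_dist_le_of_disjoint hL hlen hxz hyw hdisj.symm
    rw [dist_self]
    linarith [hηm.trans_le (min_le_left _ _)]
  · have hm0 : 0 < dist y' m := dist_pos.2 hm
    obtain ⟨η, hη, hηm⟩ := exists_between (lt_min (half_pos hε) (lt_min hp0 hm0))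
    obtain ⟨hηε, hηpm⟩ := lt_min_iff.1 hηm
    obtain ⟨hηp, hηm⟩ := lt_min_iff.1 hηpm
    obtain ⟨w, hw, hyw, hd, hdisj⟩ := hX.exists_shortened_segment hmin hη hηp
    obtain ⟨w', -, hyw', hd', hdisj'⟩ := hX.exists_shortened_segment hmin' hη hηm
    have := hX.dist_add_dist_add_dist_le_of_disjoint hL hlen hxz hyw hyw' hdisj.symm
      (hdisj'.mono_right subset_union_left).symm
      (hdisj'.mono_right ((metricSegment_subset_left hw).trans subset_union_right)).symm
    linarith

end TreeLength

section Circle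

theorem IntrinsicCircle.dist_add_pi (a : IntrinsicCircle) :
    dist a (a + ((π : ℝ) : IntrinsicCircle)) = π := by
  rw [dist_eq_norm, sub_add_cancel_left, norm_neg]
  have h := (AddCircle.norm_coe_eq_abs_iff (2 * π) (x := π) (by positivity)).2 (by
    rw [abs_of_pos pi_pos, abs_of_pos (by positivity)]; linarith)
  rw [h, abs_of_pos pi_pos]

theorem IntrinsicCircle.dist_add_coe_le (a : IntrinsicCircle) {s : ℝ} (hs : 0 ≤ s) :
    dist a (a + (s : IntrinsicCircle)) ≤ s := by
  rw [dist_eq_norm, sub_add_cancel_left, norm_neg]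
  refine (QuotientAddGroup.norm_mk_le_norm).trans ?_
  rw [Real.norm_eq_abs, abs_of_nonneg hs]

theorem IntrinsicCircle.dist_le_pi (a b : IntrinsicCircle) : dist a b ≤ π := by
  rw [dist_eq_norm]
  refine (AddCircle.norm_le_half_period (2 * π) (by positivity)).trans ?_
  rw [abs_of_pos (by positivity)]
  linarith

theorem IntrinsicCircle.coe_add_pi_add_pi (t : ℝ) :
    ((t + π + π : ℝ) : IntrinsicCircle) = (t : IntrinsicCircle) := by
  rw [show t + π + π = t + 2 * π by ring]
  exact AddCircle.coe_add_period _ _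

/-- A Gromov–Hausdorff bound provides an almost optimal map which is half of an almost
optimal correspondence. -/
theorem exists_map_of_ghDist_le {X Y : Type*} [MetricSpace X] [MetricSpace Y] {r : ℝ}
    (hr : 0 ≤ r) (h : ghDist X Y ≤ ENNReal.ofReal r) {ε : ℝ} (hε : 0 < ε) :
    ∃ f : Y → X, (∀ a b, |dist (f a) (f b) - dist a b| ≤ 2 * r + ε) ∧
      ∀ c, ∃ b, ∀ a, |dist (f a) c - dist a b| ≤ 2 * r + ε := by
  have hlt : (⨅ R : {R : Set (X × Y) // IsCorrespondence R}, distortion (R : Set (X × Y))) <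
      ENNReal.ofReal (2 * r + ε) := by
    refine lt_of_le_of_lt ?_ ((ENNReal.ofReal_lt_ofReal_iff (by linarith)).2
      (show 2 * r < 2 * r + ε by linarith))
    rw [ghDist, ENNReal.div_le_iff (by norm_num) (by norm_num)] at h
    rwa [mul_comm 2 r, ENNReal.ofReal_mul hr, ENNReal.ofReal_ofNat]
  obtain ⟨⟨R, hR⟩, hlt⟩ := iInf_lt_iff.1 hlt
  have hdist : ∀ p ∈ R, ∀ q ∈ R, |dist p.1 q.1 - dist p.2 q.2| ≤ 2 * r + ε := by
    intro p hp q hq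
    rw [← ENNReal.ofReal_le_ofReal_iff (by linarith)]
    exact (le_iSup₂_of_le (f := fun p q : R => ENNReal.ofReal
      |dist (p : X × Y).1 (q : X × Y).1 - dist (p : X × Y).2 (q : X × Y).2|)
      ⟨p, hp⟩ ⟨q, hq⟩ le_rfl).trans hlt.le
  choose f hf using hR.2
  refine ⟨f, fun a b => hdist _ (hf a) _ (hf b), fun c => ?_⟩
  obtain ⟨b, hb⟩ := hR.1 c
  exact ⟨b, fun a => hdist _ (hf a) _ hb⟩

/-- A discrete Borsuk–Ulam theorem for not necessarily continuous functions on the circle. -/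
theorem exists_antipodal_crossing (F : IntrinsicCircle → ℝ) {ε : ℝ} (hε : 0 < ε) :
    ∃ a b : IntrinsicCircle, dist a b ≤ ε ∧
      F a ≤ F (a + (π : ℝ)) ∧ F (b + (π : ℝ)) ≤ F b := by
  obtain ⟨N, hN⟩ := exists_nat_gt (π / ε)
  have hN0 : (0 : ℝ) < N := (by positivity : (0 : ℝ) < π / ε).trans hN
  have hs : π / N ≤ ε := by
    rw [div_le_iff₀ hN0]
    rw [div_lt_iff₀ hε] at hN
    linarith
  let G : ℝ → ℝ := fun t => F (t : ℝ) - F ((t : IntrinsicCircle) + (π : ℝ))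
  have hG : G π = -G 0 := by
    have := IntrinsicCircle.coe_add_pi_add_pi 0
    simp only [zero_add, AddCircle.coe_add, AddCircle.coe_zero] at this
    simp [G, this]
  have hstep : ∀ k : ℕ, dist ((k * (π / N) : ℝ) : IntrinsicCircle)
      (((k + 1 : ℕ) * (π / N) : ℝ) : IntrinsicCircle) ≤ ε := by
    intro k
    rw [Nat.cast_succ, add_mul, one_mul, AddCircle.coe_add]
    exact (IntrinsicCircle.dist_add_coe_le _ (by positivity)).trans hs
  have hend : ((N : ℝ) * (π / N)) = π := by field_simp
  by_contra! hcon
  rcases le_or_gt (G 0) 0 with h0 | h0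
  · have hneg : ∀ k : ℕ, G (k * (π / N)) ≤ 0 := by
      intro k
      induction k with
      | zero => simpa using h0
      | succ k ih =>
        have := hcon _ _ (hstep k) (by simp only [G] at ih; linarith)
        simp only [G]
        linarith
    have hzero : ∀ a : IntrinsicCircle, F a ≤ F (a + (π : ℝ)) → F a < F (a + (π : ℝ)) :=
      fun a ha => hcon a a (by simpa using hε.le) ha
    have h₁ := hneg N
    rw [hend, hG] at h₁
    have h₂ := hzero ((0 : ℝ) : IntrinsicCircle) (by simp only [G] at h0; linarith)
    simp only [G] at h₁
    linarith
  · have hpos : ∀ k : ℕ, 0 < G (k * (π / N)) := by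
      intro k
      induction k with
      | zero => simpa using h0
      | succ k ih =>
        by_contra! hk
        simp only [G] at hk ih
        have := hcon _ _ ((dist_comm _ _).trans_le (hstep k)) (by linarith)
        linarith
    have h₁ := hpos N
    rw [hend, hG] at h₁
    linarith

end Circle

/-- The numerical core of the crossing argument: `a₁, a₂` and `b₁, b₂` are positions along an
interval of the feet of two pairs of points, and `g₁, g₂, h₁, h₂` their heights. -/
theorem crossing_heights {c e a₁ a₂ b₁ b₂ g₁ g₂ h₁ h₂ : ℝ}
    (hg₁ : g₁ < c - 3 * e) (hg₂ : g₂ < c - 3 * e) (hh₁ : h₁ < c - 3 * e) (hh₂ : h₂ < c - 3 * e)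
    (ha : a₁ ≠ a₂ → |a₁ - a₂| + g₁ + g₂ ≤ 2 * c + 2 * e)
    (hb : b₁ ≠ b₂ → |b₁ - b₂| + h₁ + h₂ ≤ 2 * c + 2 * e)
    (h₁₁ : 2 * c - 2 * e ≤ |a₁ - b₁| + g₁ + h₁) (h₁₂ : 2 * c - 2 * e ≤ |a₁ - b₂| + g₁ + h₂)
    (h₂₁ : 2 * c - 2 * e ≤ |a₂ - b₁| + g₂ + h₁) (h₂₂ : 2 * c - 2 * e ≤ |a₂ - b₂| + g₂ + h₂)
    (he : 0 ≤ e) (hcross₁ : a₁ ≤ b₁) (hcross₂ : b₂ ≤ a₂) : False := by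
  rw [abs_of_nonpos (by linarith)] at h₁₁
  rw [abs_of_nonneg (by linarith)] at h₂₂
  rcases lt_trichotomy a₁ a₂ with h | h | h <;> rcases lt_trichotomy b₁ b₂ with h' | h' | h' <;>
    rcases abs_cases (a₁ - b₂) with k | k <;> rcases abs_cases (a₂ - b₁) with l | l <;>
    rcases abs_cases (a₁ - a₂) with m | m <;> rcases abs_cases (b₁ - b₂) with n | n <;>
    first
    | linarith
    | linarith [ha h.ne]
    | linarith [ha h.ne']
    | linarith [hb h'.ne]
    | linarith [hb h'.ne']

section CircleApproximation

variable {X : Type*} [MetricSpace X]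

theorem isBounded_of_ghDist_circle_le
    (hGH : ghDist X IntrinsicCircle ≤ ENNReal.ofReal (π / 4)) :
    Bornology.IsBounded (univ : Set X) := by
  obtain ⟨f, -, hf⟩ := exists_map_of_ghDist_le (by positivity) hGH one_pos
  refine (Metric.isBounded_iff_subset_closedBall (f 0)).2 ⟨π + (2 * (π / 4) + 1), fun c _ => ?_⟩
  obtain ⟨b, hb⟩ := hf c
  have h₁ := abs_le.1 (hb 0)
  have h₂ := IntrinsicCircle.dist_le_pi 0 b
  rw [mem_closedBall, dist_comm]
  linarith

theorem IsRTree.exists_nearest (hX : IsRTree X) (x z y : X) :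
    ∃ p ∈ metricSegment x z, ∀ q ∈ metricSegment x z, dist y p ≤ dist y q := by
  obtain ⟨p, hp, hd⟩ := (hX.isCompact_metricSegment x z).exists_infDist_eq_dist
    ⟨x, left_mem_metricSegment x z⟩ y
  exact ⟨p, hp, fun q hq => hd ▸ infDist_le_dist_of_mem hq⟩

theorem IsRTree.dist_eq_abs_sub (hX : IsRTree X) {x z p q : X} (hp : p ∈ metricSegment x z)
    (hq : q ∈ metricSegment x z) : dist p q = |dist x p - dist x q| := by
  rcases hX.mem_or_mem_of_mem_metricSegment hp hq with h | h
  · have h' : dist x q + dist q p = dist x p := h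
    rw [← h', add_sub_cancel_left, abs_of_nonneg dist_nonneg, dist_comm]
  · have e₁ : dist x p + dist p z = dist x z := hp
    have e₂ : dist x q + dist q z = dist x z := hq
    have e₃ : dist p q + dist q z = dist p z := h
    rw [show dist x p - dist x q = -dist p q by linarith, abs_neg, abs_of_nonneg dist_nonneg]

/-- An `ℝ`-tree at Gromov–Hausdorff distance at most `π/4` from the circle has diameter at
least `π`: otherwise the midpoint of a diameter is too close to all other points. -/
theorem IsRTree.pi_le_dist (hX : IsRTree X)
    (hGH : ghDist X IntrinsicCircle ≤ ENNReal.ofReal (π / 4)) {x z : X}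
    (hmax : ∀ u v : X, dist u v ≤ dist x z) : π ≤ dist x z := by
  have hd : (0 : ℝ) ≤ dist x z := dist_nonneg
  obtain ⟨c, hc, hxc⟩ := hX.exists_mem_metricSegment_dist_eq x z (t := dist x z / 2)
    ⟨by linarith, by linarith⟩
  refine le_of_forall_pos_le_add fun ε hε => ?_
  obtain ⟨f, -, hf⟩ := exists_map_of_ghDist_le (by positivity) hGH (half_pos hε)
  obtain ⟨b, hb⟩ := hf c
  have hlow := abs_le.1 (hb (b + (π : ℝ)))
  rw [dist_comm (b + _) b, IntrinsicCircle.dist_add_pi] at hlow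
  set y := f (b + (π : ℝ))
  obtain ⟨p, hp, hmin⟩ := hX.exists_nearest x z y
  have e₁ := hX.dist_eq_of_nearest hp hmin (left_mem_metricSegment x z)
  have e₂ := hX.dist_eq_of_nearest hp hmin (right_mem_metricSegment x z)
  have e₃ := hX.dist_eq_of_nearest hp hmin hc
  have e₄ := hX.dist_eq_abs_sub hp hc
  have e₅ : dist x p + dist p z = dist x z := hp
  have h₁ := hmax y x
  have h₂ := hmax y z
  rw [dist_comm p x] at e₁
  rcases abs_cases (dist x p - dist x c) with k | k <;> linarith

/-- An `ℝ`-tree at Gromov–Hausdorff distance at most `π/4` from the circle is not contained in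
a neighborhood of a segment of radius less than `π/4`. -/
theorem IsRTree.exists_far_point (hX : IsRTree X)
    (hGH : ghDist X IntrinsicCircle ≤ ENNReal.ofReal (π / 4)) (x z : X) {ε : ℝ} (hε : 0 < ε) :
    ∃ y : X, ∀ q ∈ metricSegment x z, π / 4 - ε ≤ dist y q := by
  by_contra! hcon
  choose foot hfoot hmin using hX.exists_nearest x z
  have hheight : ∀ y, dist y (foot y) < π / 4 - 3 * (ε / 3) := by
    intro y
    obtain ⟨q, hq, hlt⟩ := hcon y
    linarith [hmin y q hq]
  have hε' : 0 < ε / 3 := by positivity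
  obtain ⟨f, hf, -⟩ := exists_map_of_ghDist_le (by positivity) hGH hε'
  obtain ⟨a, b, hab, ha, hb⟩ := exists_antipodal_crossing (fun t => dist x (foot (f t))) hε'
  have hnear : ∀ s t, dist s t ≤ ε / 3 →
      dist x (foot (f s)) ≠ dist x (foot (f t)) →
      |dist x (foot (f s)) - dist x (foot (f t))| + dist (f s) (foot (f s)) +
        dist (f t) (foot (f t)) ≤ 2 * (π / 4) + 2 * (ε / 3) := by
    intro s t hst hne
    rw [← hX.dist_eq_abs_sub (hfoot _) (hfoot _)]
    have h₁ := hX.dist_eq_of_nearest_ne (hfoot (f s)) (hmin (f s)) (hfoot (f t)) (hmin (f t))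
      (fun h => hne (by rw [h]))
    have h₂ := abs_le.1 (hf s t)
    linarith
  have hfar : ∀ s t, π - ε / 3 ≤ dist s t → 2 * (π / 4) - 2 * (ε / 3) ≤
      |dist x (foot (f s)) - dist x (foot (f t))| + dist (f s) (foot (f s)) +
        dist (f t) (foot (f t)) := by
    intro s t hst
    rw [← hX.dist_eq_abs_sub (hfoot _) (hfoot _)]
    have h₁ := dist_triangle4 (f s) (foot (f s)) (foot (f t)) (f t)
    rw [dist_comm (foot (f t)) (f t)] at h₁
    have h₂ := abs_le.1 (hf s t)
    linarith
  have haa := IntrinsicCircle.dist_add_pi a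
  have hbb := IntrinsicCircle.dist_add_pi b
  refine crossing_heights (hheight (f a)) (hheight (f b)) (hheight (f (a + (π : ℝ))))
    (hheight (f (b + (π : ℝ)))) (hnear a b hab) (hnear _ _ (by rwa [dist_add_right]))
    (hfar _ _ (by linarith)) (hfar _ _ ?_) (hfar _ _ ?_) (hfar _ _ (by linarith)) hε'.le ha hb
  · linarith [dist_triangle b a (b + (π : ℝ)), dist_comm a b]
  · linarith [dist_triangle a b (a + (π : ℝ))]

/-- In a complete `ℝ`-tree of length at most `5π/4` at Gromov–Hausdorff distance at most `π/4`
from the circle, some point is at distance at least `π/4` from a given segment of length at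
least `π`. -/
theorem IsRTree.exists_extreme_point [CompleteSpace X] (hX : IsRTree X)
    (hlen : treeLength X ≤ ENNReal.ofReal (5 * π / 4))
    (hGH : ghDist X IntrinsicCircle ≤ ENNReal.ofReal (π / 4)) {x z : X} (hxz : π ≤ dist x z) :
    ∃ y : X, ∀ q ∈ metricSegment x z, π / 4 ≤ dist y q := by
  have hne : x ≠ z := dist_pos.1 (pi_pos.trans_le hxz)
  have hδ : ∀ n : ℕ, 0 < (π / 16) / (n + 1 : ℝ) := fun n => by positivity
  choose y hy using fun n : ℕ => hX.exists_far_point hGH x z (hδ n)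
  have hanti : ∀ n m : ℕ, n ≤ m → (π / 16) / (m + 1 : ℝ) ≤ (π / 16) / (n + 1 : ℝ) := by
    intro n m hnm
    have : (n : ℝ) ≤ m := by exact_mod_cast hnm
    gcongr
  have hsmall : ∀ n : ℕ, (π / 16) / (n + 1 : ℝ) ≤ π / 16 := by
    intro n
    simpa using hanti 0 n (Nat.zero_le n)
  have hclose : ∀ n m : ℕ, n ≤ m → dist (y n) (y m) ≤ 2 * ((π / 16) / (n + 1 : ℝ)) := by
    intro n m hnm
    obtain ⟨p, hp, hmin⟩ := hX.exists_nearest x z (y n)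
    have hp' := hy n p hp
    have hpos := pi_pos
    have hyp : y n ≠ p := dist_pos.1 (by linarith [hsmall n])
    obtain ⟨w, hw, hd⟩ := ((hX.isCompact_metricSegment x z).union
      (hX.isCompact_metricSegment (y n) p)).exists_infDist_eq_dist
      ⟨x, Or.inl (left_mem_metricSegment x z)⟩ (y m)
    have hsum := hX.dist_add_dist_add_dist_le (by positivity) hlen hne hmin hyp
      (y' := y m) (m := w) (fun q hq => hd ▸ infDist_le_dist_of_mem hq)
    rcases hw with hw | hw
    · linarith [hy m w hw, hsmall n, hsmall m]
    · have e : dist (y n) w + dist w p = dist (y n) p := hw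
      have h₁ := dist_triangle (y m) w p
      have h₂ := dist_triangle (y n) w (y m)
      linarith [hy m p hp, hanti n m hnm, dist_comm w (y m)]
  have hlim : Filter.Tendsto (fun n : ℕ => (π / 16) / (n + 1 : ℝ)) Filter.atTop (nhds 0) :=
    tendsto_const_div_atTop_nhds_zero_nat (π / 16) |>.comp (Filter.tendsto_add_atTop_nat 1)
      |>.congr fun n => by simp
  have hcauchy : CauchySeq y := by
    refine cauchySeq_of_le_tendsto_0' (fun n : ℕ => 2 * ((π / 16) / (n + 1 : ℝ))) hclose ?_
    simpa using hlim.const_mul 2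
  obtain ⟨y₀, hy₀⟩ := cauchySeq_tendsto_of_complete hcauchy
  refine ⟨y₀, fun q hq => ?_⟩
  refine le_of_tendsto_of_tendsto' ?_ (hy₀.dist tendsto_const_nhds) fun n => hy n q hq
  simpa using hlim.const_sub (π / 4)

end CircleApproximation

/-- **Claim 4.8.** Let `X` be a complete `ℝ`-tree of length `≤ 5π/4` with
`d_GH(X, S¹) = π/4`, and let `xminus, xplus ∈ X` realize the diameter of `X`. Then
`diam X = π` and `X` is a tripod: there are a point `x₁`, the geodesic segment
(arc) `A` from `xminus` to `xplus`, and the arc `B` from `x₁` to its nearest-point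
projection `p ∈ A`, such that `d(x₁, p) = d(x₁, A) = π/4` and `X = A ∪ B`. -/
theorem rtree_is_tripod {X : Type*} [MetricSpace X] [CompleteSpace X]
    (hX : IsRTree X) (hlen : treeLength X ≤ ENNReal.ofReal (5 * π / 4))
    (hGH : ghDist X IntrinsicCircle = ENNReal.ofReal (π / 4))
    (xminus xplus : X) (hdiam : dist xminus xplus = Metric.diam (Set.univ : Set X)) :
    Metric.diam (Set.univ : Set X) = π ∧
    ∃ (x₁ p : X) (A B : Set X),
      IsArcBetween xminus xplus A ∧ p ∈ A ∧ IsArcBetween x₁ p B ∧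
      dist x₁ p = π / 4 ∧ (∀ q ∈ A, dist x₁ p ≤ dist x₁ q) ∧
      A ∪ B = Set.univ := by
  have hmax : ∀ u v : X, dist u v ≤ dist xminus xplus := fun u v =>
    hdiam ▸ dist_le_diam_of_mem (isBounded_of_ghDist_circle_le hGH.le) (mem_univ u) (mem_univ v)
  have hpi := hX.pi_le_dist hGH.le hmax
  have hne : xminus ≠ xplus := dist_pos.1 (pi_pos.trans_le hpi)
  obtain ⟨x₁, hx₁⟩ := hX.exists_extreme_point hlen hGH.le hpi
  obtain ⟨p, hp, hmin⟩ := hX.exists_nearest xminus xplus x₁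
  have hx₁p := hx₁ p hp
  have hpos := pi_pos
  have hne₁ : x₁ ≠ p := dist_pos.1 (by linarith)
  have hsum : ∀ y m : X,
      (∀ q ∈ metricSegment xminus xplus ∪ metricSegment x₁ p, dist y m ≤ dist y q) →
      dist xminus xplus + dist x₁ p + dist y m ≤ 5 * π / 4 := fun y m h =>
    hX.dist_add_dist_add_dist_le (by positivity) hlen hne hmin hne₁ h
  have h₀ := hsum x₁ x₁ fun q _ => by rw [dist_self]; exact dist_nonneg
  rw [dist_self] at h₀
  refine ⟨by linarith, x₁, p, metricSegment xminus xplus, metricSegment x₁ p,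
    hX.isArcBetween_metricSegment hne, hp, hX.isArcBetween_metricSegment hne₁,
    by linarith, hmin, eq_univ_of_forall fun y => ?_⟩
  obtain ⟨m, hm, hd⟩ := ((hX.isCompact_metricSegment xminus xplus).union
    (hX.isCompact_metricSegment x₁ p)).exists_infDist_eq_dist ⟨p, Or.inl hp⟩ y
  have h₁ := hsum y m fun q hq => hd ▸ infDist_le_dist_of_mem hq
  have hym : y = m := dist_le_zero.1 (by linarith)
  exact hym ▸ hm

end
end

section
/- Let T be the ℝ-tree consisting of four segments of length π/4 glued at a common endpoint (a 4-star with leaves p₁, p₂, p₃, p₄), so that T has length π. Then there exists a metric space Z containing isometric copies of T and of S¹ (with its intrinsic metric) such that every point of S¹ is at distance ≤ π/4 from T in Z; more precisely, dividing S¹ into four closed arcs I₁, I₂, I₃, I₄ of length π/2, one can metrize the disjoint union S¹ ⊔ T, extending both metrics, so that for each i every point of I_i is at distance π/4 from p_i. -/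
open Real Set Metric
open scoped ENNReal unitInterval

noncomputable section

/-- The `4`-star `T`: four segments of length `π/4` glued at a common endpoint (the
origin), realized as a union of coordinate segments in `ℝ⁴` with the `ℓ¹`-metric; the
induced metric is exactly the path metric of the star.  It is an `ℝ`-tree of length `π`. -/
def Star4Set : Set (PiLp 1 fun _ : Fin 4 => ℝ) :=
  {p | ∃ (i : Fin 4) (t : ℝ), 0 ≤ t ∧ t ≤ π / 4 ∧
    p = (WithLp.equiv 1 (∀ _ : Fin 4, ℝ)).symm (fun j => if j = i then t else 0)}

abbrev Star4 : Type := ↥Star4Set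

/-- The leaf `pᵢ` of the `4`-star, at distance `π/4` from the center. -/
noncomputable def star4Leaf (i : Fin 4) : Star4 :=
  ⟨(WithLp.equiv 1 (∀ _ : Fin 4, ℝ)).symm (fun j => if j = i then π / 4 else 0),
    ⟨i, π / 4, by positivity, le_rfl, rfl⟩⟩

lemma dist_star4Leaf_of_ne {i j : Fin 4} (h : i ≠ j) :
    dist (star4Leaf i) (star4Leaf j) = π / 2 := by
  rw [Subtype.dist_eq, PiLp.dist_eq_of_L1]
  simp only [star4Leaf, Real.dist_eq, WithLp.equiv_symm_apply]
  fin_cases i <;> fin_cases j <;>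
    first
    | exact absurd rfl h
    | (simp [Fin.sum_univ_four, abs_of_pos (show 0 < π / 4 by positivity)]; ring)

lemma dist_intrinsicCircle_le_pi (x y : IntrinsicCircle) : dist x y ≤ π := by
  rw [dist_eq_norm]
  refine (AddCircle.norm_le_half_period (2 * π) (by positivity)).trans_eq ?_
  rw [abs_of_pos two_pi_pos]
  ring

lemma dist_coe_intrinsicCircle_le (x y : ℝ) :
    dist (x : IntrinsicCircle) (y : IntrinsicCircle) ≤ |x - y| := by
  rw [dist_eq_norm, ← AddCircle.coe_sub, ← Real.norm_eq_abs]
  exact QuotientAddGroup.norm_mk_le_norm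

/-- The closed arc `Iᵢ`, lifted to an interval of the real line. -/
def quarterArc (i : Fin 4) : Set ℝ :=
  Set.Icc ((i : ℕ) * (π / 2)) (((i : ℕ) + 1) * (π / 2))

lemma exists_mem_quarterArc (q : IntrinsicCircle) :
    ∃ i, ∃ x ∈ quarterArc i, (x : IntrinsicCircle) = q := by
  obtain ⟨x, hx, rfl⟩ : q ∈ ((↑) : ℝ → IntrinsicCircle) '' Set.Ico 0 (0 + 2 * π) := by
    rw [AddCircle.coe_image_Ico_eq]
    trivial
  have hp := pi_pos
  obtain ⟨h₀, h₄⟩ := hx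
  simp only [quarterArc, Set.mem_Icc]
  rcases le_total x (π / 2) with h₁ | h₁
  · exact ⟨0, x, ⟨by simpa using h₀, by simpa using h₁⟩, rfl⟩
  rcases le_total x π with h₂ | h₂
  · exact ⟨1, x, ⟨by norm_num; linarith, by norm_num; linarith⟩, rfl⟩
  rcases le_total x (3 * (π / 2)) with h₃ | h₃
  · exact ⟨2, x, ⟨by norm_num; linarith, by norm_num; linarith⟩, rfl⟩
  · exact ⟨3, x, ⟨by norm_num; linarith, by norm_num; linarith⟩, rfl⟩

/-- The correspondence pairing `pᵢ` with the points of `Iᵢ` has distortion at most `π/2`. -/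
lemma abs_dist_star4Leaf_sub_dist_le (p q : Σ i, quarterArc i) :
    |dist (star4Leaf p.1) (star4Leaf q.1) -
      dist ((p.2 : ℝ) : IntrinsicCircle) ((q.2 : ℝ) : IntrinsicCircle)| ≤ 2 * (π / 4) := by
  obtain ⟨i, x, hx⟩ := p
  obtain ⟨j, y, hy⟩ := q
  rcases eq_or_ne i j with rfl | h
  · have hxy : |x - y| ≤ π / 2 :=
      (Real.dist_le_of_mem_Icc hx hy).trans_eq (by ring)
    rw [dist_self, zero_sub, abs_neg, abs_of_nonneg dist_nonneg]
    linarith [dist_coe_intrinsicCircle_le x y]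
  · have h₁ := dist_intrinsicCircle_le_pi x y
    have h₀ : 0 ≤ dist (x : IntrinsicCircle) y := dist_nonneg
    rw [dist_star4Leaf_of_ne h, abs_le]
    constructor <;> linarith

/-- One can metrize the disjoint union of `S¹` and the `4`-star `T` (i.e. embed both
isometrically into a common metric space `Z`), extending both metrics, so that every
point of `S¹` is at distance `≤ π/4` from `T`; more precisely, so that for each
`i = 0, 1, 2, 3` every point of the arc `Iᵢ = [i·π/2, (i+1)·π/2] mod 2π` is at distance
exactly `π/4` from the leaf `pᵢ`. -/
theorem star4_circle_within_pi_div_four :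
    ∃ (Z : Type) (mZ : MetricSpace Z),
      letI := mZ
      ∃ (f : Star4 → Z) (g : IntrinsicCircle → Z),
        Isometry f ∧ Isometry g ∧
        (∀ q : IntrinsicCircle, Metric.infDist (g q) (Set.range f) ≤ π / 4) ∧
        ∀ i : Fin 4, ∀ x ∈ Set.Icc ((i : ℕ) * (π / 2)) (((i : ℕ) + 1) * (π / 2)),
          dist (g ((x : ℝ) : IntrinsicCircle)) (f (star4Leaf i)) = π / 4 := by
  have : Nonempty (Σ i, quarterArc i) :=
    let ⟨i, x, hx, _⟩ := exists_mem_quarterArc 0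
    ⟨⟨i, x, hx⟩⟩
  let Φ : (Σ i, quarterArc i) → Star4 := fun p => star4Leaf p.1
  let Ψ : (Σ i, quarterArc i) → IntrinsicCircle := fun p => ((p.2 : ℝ) : IntrinsicCircle)
  let mZ : MetricSpace (Star4 ⊕ IntrinsicCircle) :=
    glueMetricApprox Φ Ψ (π / 4) (by positivity) abs_dist_star4Leaf_sub_dist_le
  have hglue : ∀ i : Fin 4, ∀ x ∈ quarterArc i,
      dist (Sum.inr (x : IntrinsicCircle) : Star4 ⊕ IntrinsicCircle)
        (Sum.inl (star4Leaf i)) = π / 4 := fun i x hx => by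
    rw [dist_comm]
    exact glueDist_glued_points Φ Ψ (π / 4) ⟨i, x, hx⟩
  refine ⟨Star4 ⊕ IntrinsicCircle, mZ, Sum.inl, Sum.inr, Isometry.of_dist_eq fun _ _ => rfl,
    Isometry.of_dist_eq fun _ _ => rfl, fun q => ?_, hglue⟩
  obtain ⟨i, x, hx, rfl⟩ := exists_mem_quarterArc q
  exact (infDist_le_dist_of_mem (Set.mem_range_self (star4Leaf i))).trans_eq (hglue i x hx)

end
end
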